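/- arXiv:1508.05540 — 2 statements merged into one kernel-verified Lean document; each statement's English description precedes it below -/
import Mathlib

section
/- Let F be a finite extension of ℚ₂ of degree n, and let E/F be a Galois extension with Gal(E/F) ≅ (ℤ/2ℤ)². Then the kernel of the induced norm map Nm: E×/(E×)² → F×/(F×)² has order 2^{3n+2}. -/
/-- The subgroup of squares of `Fˣ`. -/
def sqSubgroup (F : Type*) [Field F] : Subgroup Fˣ := (powMonoidHom 2 : Fˣ →* Fˣ).range

/-- The map `E×/(E×)² → F×/(F×)²` induced by the norm. -/
noncomputable def normSqClasses (F E : Type*) [Field F] [Field E] [Algebra F E] :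
    Eˣ ⧸ sqSubgroup E →* Fˣ ⧸ sqSubgroup F :=
  QuotientGroup.map _ _ (Units.map (Algebra.norm F : E →* F)) (by
    rintro x ⟨y, rfl⟩
    exact ⟨Units.map (Algebra.norm F : E →* F) y, by
      simp [powMonoidHom_apply, map_pow]⟩)


theorem herbrand_index {A B : Type*} [CommGroup A] [CommGroup B] (φ : B →* A)
    (hφ : Function.Injective φ) (hfin : φ.range.index ≠ 0) (htors : ∀ b : B, b ^ 2 = 1 → b = 1) :
    (powMonoidHom 2 : A →* A).range.index =
      (powMonoidHom 2 : B →* B).range.index * Nat.card (powMonoidHom 2 : A →* A).ker := by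
  set s : A →* A := powMonoidHom 2 with hs
  set t : B →* B := powMonoidHom 2 with ht
  have h1 := Subgroup.index_map φ.range s
  have hle : φ.range.map s ≤ φ.range := by
    rintro _ ⟨_, ⟨b, rfl⟩, rfl⟩
    exact ⟨b ^ 2, by simp [hs]⟩
  have h2 := Subgroup.relIndex_mul_index hle
  have h3 : (φ.range.map s).relIndex φ.range = t.range.index := by
    have e1 : φ.range.map s = t.range.map φ := by
      rw [MonoidHom.map_range, MonoidHom.map_range]
      congr 1
      ext b
      simp [hs, ht]
    rw [e1, ← Subgroup.relIndex_top_right, MonoidHom.range_eq_map φ]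
    exact Subgroup.relIndex_map_map_of_injective _ _ hφ
  have h4 := Subgroup.relIndex_mul_index (le_sup_left : φ.range ≤ φ.range ⊔ s.ker)
  have h5 : φ.range.relIndex (φ.range ⊔ s.ker) = Nat.card s.ker := by
    rw [Subgroup.relIndex_sup_left, ← Subgroup.inf_relIndex_right]
    have : φ.range ⊓ s.ker = ⊥ := by
      rw [eq_bot_iff]
      rintro _ ⟨⟨b, rfl⟩, hb⟩
      have hb' : φ b ^ 2 = 1 := hb
      rw [← map_pow, ← map_one φ] at hb'
      simp [htors b (hφ hb')]
    rw [this, Subgroup.relIndex_bot_left]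
  rw [h5] at h4
  rw [h3, h1, ← h4] at h2
  have h6 : (φ.range ⊔ s.ker).index ≠ 0 := by
    intro h
    rw [h, mul_zero] at h4
    exact hfin h4.symm
  apply Nat.eq_of_mul_eq_mul_left (Nat.pos_of_ne_zero h6)
  rw [← h2]; ring

section local_count
variable {K : Type*} [NormedField K] [IsUltrametricDist K]

/-- closed ball as additive subgroup -/
def ballB (K : Type*) [NormedField K] [IsUltrametricDist K] (r : ℝ) (hr : 0 ≤ r) : AddSubgroup K where
  carrier := {x | ‖x‖ ≤ r}
  zero_mem' := by simpa using hr
  add_mem' {x y} hx hy := (IsUltrametricDist.norm_add_le_max x y).trans (max_le hx hy)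
  neg_mem' {x} hx := by simpa using hx

theorem mem_ballB {r : ℝ} {hr : 0 ≤ r} {x : K} : x ∈ ballB K r hr ↔ ‖x‖ ≤ r := Iff.rfl

theorem norm_eq_one_of_near {x : K} {r : ℝ} (h1 : r < 1) (hx : ‖x - 1‖ ≤ r) : ‖x‖ = 1 := by
  have := IsUltrametricDist.norm_add_eq_max_of_norm_ne_norm (x := x - 1) (y := 1)
    (by rw [norm_one]; linarith)
  rw [sub_add_cancel, norm_one, max_eq_right (by linarith)] at this
  exact this

/-- higher unit group -/
def unitV (K : Type*) [NormedField K] [IsUltrametricDist K] (r : ℝ) (hr : 0 ≤ r) (h1 : r < 1) :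
    Subgroup Kˣ where
  carrier := {u | ‖(u : K) - 1‖ ≤ r}
  one_mem' := by simpa using hr
  mul_mem' {x y} hx hy := by
    have : ((x * y : Kˣ) : K) - 1 = x * (y - 1) + (x - 1) := by push_cast; ring
    change ‖((x * y : Kˣ) : K) - 1‖ ≤ r
    rw [this]
    refine (IsUltrametricDist.norm_add_le_max _ _).trans (max_le ?_ hx)
    rw [norm_mul, norm_eq_one_of_near h1 hx, one_mul]
    exact hy
  inv_mem' {x} hx := by
    change ‖((x⁻¹ : Kˣ) : K) - 1‖ ≤ r
    have : ((x⁻¹ : Kˣ) : K) - 1 = -(((x⁻¹ : Kˣ) : K) * (x - 1)) := by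
      rw [mul_sub, Units.inv_mul]; ring
    rw [this, norm_neg, norm_mul, Units.val_inv_eq_inv_val, norm_inv, norm_eq_one_of_near h1 hx]
    simpa using hx

theorem mem_unitV {r : ℝ} {hr : 0 ≤ r} {h1 : r < 1} {x : Kˣ} :
    x ∈ unitV K r hr h1 ↔ ‖(x : K) - 1‖ ≤ r := Iff.rfl

theorem ballB_scale (h2 : ‖(2 : K)‖ = 1 / 2) (r s : ℝ) (hr : 0 ≤ r) (hs : 0 ≤ s) :
    (ballB K (r / 2) (by positivity)).relIndex (ballB K (s / 2) (by positivity)) =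
    (ballB K r hr).relIndex (ballB K s hs) := by
  have h20 : (2 : K) ≠ 0 := by intro h; rw [h, norm_zero] at h2; norm_num at h2
  have key : ∀ (t : ℝ) (ht : 0 ≤ t), ballB K (t / 2) (by positivity) =
      (ballB K t ht).map (AddMonoidHom.mulLeft (2 : K)) := by
    intro t ht
    ext x
    simp only [AddSubgroup.mem_map, mem_ballB, AddMonoidHom.coe_mulLeft]
    constructor
    · intro hx
      refine ⟨x / 2, ?_, by field_simp⟩
      rw [norm_div, h2]; linarith
    · rintro ⟨y, hy, rfl⟩
      rw [norm_mul, h2]; linarith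
  rw [key r hr, key s hs]
  exact AddSubgroup.relIndex_map_map_of_injective _ _ (mul_right_injective₀ h20)

theorem unitV_relIndex :
    (unitV K (1/8) (by norm_num) (by norm_num)).relIndex (unitV K (1/4) (by norm_num) (by norm_num)) =
    (ballB K (1/8) (by norm_num)).relIndex (ballB K (1/4) (by norm_num)) := by
  set V := unitV K (1/4) (by norm_num) (by norm_num)
  set V' := unitV K (1/8) (by norm_num) (by norm_num)
  set B := ballB K (1/4) (by norm_num)
  set B' := ballB K (1/8) (by norm_num)
  let f : V →* Multiplicative (B ⧸ B'.addSubgroupOf B) :=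
    { toFun := fun u => Multiplicative.ofAdd (QuotientAddGroup.mk ⟨((u : Kˣ) : K) - 1, u.2⟩)
      map_one' := by
        rw [ofAdd_eq_one, QuotientAddGroup.eq_zero_iff]
        simp [AddSubgroup.mem_addSubgroupOf]
      map_mul' := by
        intro u v
        rw [← ofAdd_add, ← QuotientAddGroup.mk_add]
        congr 1
        rw [QuotientAddGroup.eq, AddSubgroup.mem_addSubgroupOf]
        change ‖_‖ ≤ _
        have hu : ‖((u : Kˣ) : K) - 1‖ ≤ 1 / 4 := u.2
        have hv : ‖((v : Kˣ) : K) - 1‖ ≤ 1 / 4 := v.2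
        have : ‖(((u : Kˣ) : K) - 1) * (((v : Kˣ) : K) - 1)‖ ≤ 1 / 8 := by
          rw [norm_mul]
          nlinarith [norm_nonneg (((u : Kˣ) : K) - 1), norm_nonneg (((v : Kˣ) : K) - 1)]
        rw [← norm_neg] at this
        have e : -(((u : Kˣ) : K) * ((v : Kˣ) : K) - 1) + ((((u : Kˣ) : K) - 1) + (((v : Kˣ) : K) - 1))
            = -((((u : Kˣ) : K) - 1) * (((v : Kˣ) : K) - 1)) := by ring
        rw [← e] at this
        exact this }
  have hsurj : Function.Surjective f := by
    intro q
    obtain ⟨q, rfl⟩ := Multiplicative.ofAdd.surjective q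
    obtain ⟨⟨x, hx⟩, rfl⟩ := QuotientAddGroup.mk_surjective q
    have hx' : ‖x‖ ≤ 1 / 4 := hx
    have h1 : ‖1 + x‖ = 1 := norm_eq_one_of_near (r := 1/4) (by norm_num) (by simpa using hx')
    have hne : 1 + x ≠ 0 := by rw [← norm_ne_zero_iff, h1]; norm_num
    refine ⟨⟨Units.mk0 (1 + x) hne, ?_⟩, ?_⟩
    · change ‖(1 + x) - 1‖ ≤ _
      simpa using hx'
    · simp [f]
  have hker : f.ker = V'.subgroupOf V := by
    ext u
    rw [MonoidHom.mem_ker, Subgroup.mem_subgroupOf]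
    change Multiplicative.ofAdd _ = 1 ↔ _
    rw [ofAdd_eq_one, QuotientAddGroup.eq_zero_iff, AddSubgroup.mem_addSubgroupOf]
    rfl
  rw [Subgroup.relIndex, ← hker, Subgroup.index_ker, MonoidHom.range_eq_top.mpr hsurj,
    Subgroup.card_top, AddSubgroup.relIndex, AddSubgroup.index]
  rfl

theorem exists_sqrt_near [CompleteSpace K] (h2 : ‖(2 : K)‖ = 1 / 2) (z : K) (hz : ‖z‖ ≤ 1) :
    ∃ t : K, ‖t‖ ≤ 1 ∧ t + 2 * t ^ 2 = z := by
  let s : Set K := {x | ‖x‖ ≤ 1}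
  have hs : IsClosed s := isClosed_le continuous_norm continuous_const
  have hsc : IsComplete s := hs.isComplete
  let g : K → K := fun t => z - 2 * t ^ 2
  have hmaps : Set.MapsTo g s s := by
    intro t ht
    have ht' : ‖t‖ ≤ 1 := ht
    change ‖z - 2 * t ^ 2‖ ≤ 1
    rw [sub_eq_add_neg]
    refine (IsUltrametricDist.norm_add_le_max _ _).trans (max_le hz ?_)
    rw [norm_neg, norm_mul, h2, norm_pow]
    nlinarith [norm_nonneg t]
  have hc : ContractingWith (1/2) (hmaps.restrict g s s) := by
    refine ⟨by rw [div_lt_one] <;> norm_num, ?_⟩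
    apply LipschitzWith.of_dist_le_mul
    rintro ⟨x, hx⟩ ⟨y, hy⟩
    have hx' : ‖x‖ ≤ 1 := hx
    have hy' : ‖y‖ ≤ 1 := hy
    simp only [Subtype.dist_eq, Set.MapsTo.val_restrict_apply, dist_eq_norm, g]
    have e : z - 2 * x ^ 2 - (z - 2 * y ^ 2) = 2 * (-(x + y)) * (x - y) := by ring
    rw [e, norm_mul, norm_mul, h2, norm_neg]
    have : ‖x + y‖ ≤ 1 := (IsUltrametricDist.norm_add_le_max _ _).trans (max_le hx' hy')
    push_cast
    have := mul_le_mul_of_nonneg_right this (norm_nonneg (x - y))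
    linarith
  obtain ⟨t, ht, hfix, -⟩ := hc.exists_fixedPoint' hsc hmaps (x := 0) (by simp [s]) (edist_ne_top _ _)
  refine ⟨t, ht, ?_⟩
  have : z - 2 * t ^ 2 = t := hfix
  rw [← this]
  nth_rewrite 2 [this]
  ring

theorem sq_range_unitV [CompleteSpace K] (h2 : ‖(2 : K)‖ = 1 / 2) :
    (powMonoidHom 2 : unitV K (1/4) (by norm_num) (by norm_num) →* _).range =
    (unitV K (1/8) (by norm_num) (by norm_num)).subgroupOf _ := by
  have h20 : (2 : K) ≠ 0 := by intro h; rw [h, norm_zero] at h2; norm_num at h2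
  have h4 : ‖(4 : K)‖ = 1 / 4 := by
    rw [show (4 : K) = 2 * 2 by norm_num, norm_mul, h2]; norm_num
  have h8 : ‖(8 : K)‖ = 1 / 8 := by
    rw [show (8 : K) = 2 * 4 by norm_num, norm_mul, h2, h4]; norm_num
  have h40 : (4 : K) ≠ 0 := by intro h; rw [h, norm_zero] at h4; norm_num at h4
  have h80 : (8 : K) ≠ 0 := by intro h; rw [h, norm_zero] at h8; norm_num at h8
  ext ⟨u, hu⟩
  rw [Subgroup.mem_subgroupOf]
  constructor
  · rintro ⟨⟨v, hv⟩, hvu⟩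
    have hvu' : v ^ 2 = u := congrArg Subtype.val hvu
    have hv' : ‖(v : K) - 1‖ ≤ 1 / 4 := hv
    change ‖(u : K) - 1‖ ≤ 1 / 8
    rw [← hvu']
    have : ((v ^ 2 : Kˣ) : K) - 1 = (v - 1) * ((v - 1) + 2) := by push_cast; ring
    rw [this, norm_mul]
    have h3 : ‖((v : K) - 1) + 2‖ ≤ 1 / 2 :=
      (IsUltrametricDist.norm_add_le_max _ _).trans (max_le (by linarith) h2.le)
    nlinarith [norm_nonneg ((v : K) - 1), norm_nonneg (((v : K) - 1) + 2)]
  · intro h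
    have h' : ‖(u : K) - 1‖ ≤ 1 / 8 := h
    obtain ⟨t, ht, htz⟩ := exists_sqrt_near h2 (((u : K) - 1) / 8) (by
      rw [norm_div, h8]; linarith)
    have h4t : ‖(1 + 4 * t) - 1‖ ≤ 1 / 4 := by
      rw [add_sub_cancel_left, norm_mul, h4]; linarith
    have h1 := norm_eq_one_of_near (r := 1/4) (by norm_num) h4t
    have hne : 1 + 4 * t ≠ 0 := by rw [← norm_ne_zero_iff, h1]; norm_num
    refine ⟨⟨Units.mk0 (1 + 4 * t) hne, h4t⟩, ?_⟩
    apply Subtype.ext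
    apply Units.ext
    change (1 + 4 * t) ^ 2 = (u : K)
    field_simp at htz
    linear_combination htz

theorem mult_int_sq_index :
    (powMonoidHom 2 : Multiplicative ℤ →* Multiplicative ℤ).range.index = 2 := by
  have h : (AddSubgroup.toSubgroup (AddSubgroup.zmultiples (2 : ℤ))) =
      (powMonoidHom 2 : Multiplicative ℤ →* Multiplicative ℤ).range := by
    ext x
    constructor
    · rintro ⟨k, hk⟩
      refine ⟨Multiplicative.ofAdd k, ?_⟩
      rw [← ofAdd_toAdd x]
      have hk' : k • (2 : ℤ) = x.toAdd := hk
      rw [← hk', powMonoidHom_apply, ← ofAdd_nsmul]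
      congr 1
      simp [mul_comm]
    · rintro ⟨k, rfl⟩
      refine ⟨k.toAdd, ?_⟩
      change k.toAdd • (2 : ℤ) = 2 • k.toAdd
      simp [mul_comm]
  rw [← h, AddSubgroup.index_toSubgroup, Int.index_zmultiples]
  rfl

theorem units_sq_eq_one {F : Type*} [Field F] (x : Fˣ) : x ^ 2 = 1 ↔ x = 1 ∨ x = -1 := by
  rw [Units.ext_iff, Units.ext_iff, Units.ext_iff]
  push_cast
  exact sq_eq_one_iff

theorem card_sq_ker (F : Type*) [Field F] (h20 : (2 : F) ≠ 0) :
    Nat.card (powMonoidHom 2 : Fˣ →* Fˣ).ker = 2 := by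
  have hne : (1 : Fˣ) ≠ -1 := by
    intro h
    have := congrArg Units.val h
    simp only [Units.val_one, Units.val_neg] at this
    apply h20
    linear_combination this
  have : ((powMonoidHom 2 : Fˣ →* Fˣ).ker : Set Fˣ) = {1, -1} := by
    ext x
    simp only [SetLike.mem_coe, MonoidHom.mem_ker, powMonoidHom_apply, Set.mem_insert_iff,
      Set.mem_singleton_iff]
    exact units_sq_eq_one x
  change Nat.card (((powMonoidHom 2 : Fˣ →* Fˣ).ker : Set Fˣ)) = 2
  rw [this, Nat.card_coe_set_eq, Set.ncard_pair hne]

theorem local_index [CompleteSpace K] (h2 : ‖(2 : K)‖ = 1 / 2) (m : ℕ)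
    (hO : (ballB K (1/2) (by norm_num)).relIndex (ballB K 1 (by norm_num)) = 2 ^ m) :
    (sqSubgroup K).index = 2 ^ (m + 2) := by
  have h20 : (2 : K) ≠ 0 := by intro h; rw [h, norm_zero] at h2; norm_num at h2
  have i1 : (ballB K (1/4) (by norm_num)).relIndex (ballB K (1/2) (by norm_num)) = 2 ^ m := by
    rw [← hO, ← ballB_scale h2 (1/2) 1]
    congr 2
    norm_num
  have i2 : (ballB K (1/8) (by norm_num)).relIndex (ballB K (1/4) (by norm_num)) = 2 ^ m := by
    rw [← i1, ← ballB_scale h2 (1/4) (1/2)]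
    congr 2 <;> norm_num
  have i3 : (ballB K (1/8) (by norm_num)).relIndex (ballB K 1 (by norm_num)) ≠ 0 := by
    have hle : ballB K (1/8) (by norm_num) ≤ ballB K (1/4) (by norm_num) := by
      intro x hx
      rw [mem_ballB] at *
      linarith
    have hle2 : ballB K (1/4) (by norm_num) ≤ ballB K (1/2) (by norm_num) := by
      intro x hx
      rw [mem_ballB] at *
      linarith
    have hle3 : ballB K (1/2) (by norm_num) ≤ ballB K 1 (by norm_num) := by
      intro x hx
      rw [mem_ballB] at *
      linarith
    rw [← AddSubgroup.relIndex_mul_relIndex _ _ _ hle (hle2.trans hle3),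
      ← AddSubgroup.relIndex_mul_relIndex _ _ _ hle2 hle3, i1, i2, hO]
    positivity
  set V := unitV K (1/4) (by norm_num) (by norm_num) with hV
  let two : Kˣ := Units.mk0 2 h20
  have norm_two : ∀ k : ℤ, ‖((two ^ k : Kˣ) : K)‖ = (1/2) ^ k := by
    intro k
    rw [Units.val_zpow_eq_zpow_val, norm_zpow]
    change ‖(2 : K)‖ ^ k = _
    rw [h2]
  have normV : ∀ v : Kˣ, v ∈ V → ‖(v : K)‖ = 1 := fun v hv =>
    norm_eq_one_of_near (r := 1/4) (by norm_num) hv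
  let φ : Multiplicative ℤ × V →* Kˣ := (zpowersHom Kˣ two).coprod V.subtype
  have hφ : ∀ (k : Multiplicative ℤ) (v : V), φ (k, v) = two ^ k.toAdd * (v : Kˣ) := by
    intro k v
    rfl
  have hinj : Function.Injective φ := by
    rw [injective_iff_map_eq_one]
    rintro ⟨k, v⟩ h
    rw [hφ] at h
    have hn := congrArg (fun u : Kˣ => ‖(u : K)‖) h
    simp only [Units.val_mul, norm_mul, norm_two, normV v v.2, Units.val_one, norm_one,
      mul_one] at hn
    rw [zpow_eq_one_iff_right₀ (by norm_num) (by norm_num)] at hn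
    have hk : k = 1 := by
      rw [← ofAdd_toAdd k, hn]; rfl
    subst hk
    simp only [toAdd_one, zpow_zero, one_mul] at h
    have : v = 1 := Subtype.ext h
    rw [this]; rfl
  have htors : ∀ b : Multiplicative ℤ × V, b ^ 2 = 1 → b = 1 := by
    rintro ⟨k, v⟩ h
    have hk : k ^ 2 = 1 := congrArg Prod.fst h
    have hv : v ^ 2 = 1 := congrArg Prod.snd h
    have hk' : k = 1 := by
      have : 2 • k.toAdd = 0 := by rw [← toAdd_pow, hk]; rfl
      have : k.toAdd = 0 := by simpa using this
      rw [← ofAdd_toAdd k, this]; rfl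
    have hv' : (v : Kˣ) ^ 2 = 1 := by rw [← Subgroup.coe_pow, hv]; rfl
    rcases (units_sq_eq_one (v : Kˣ)).mp hv' with h1 | h1
    · have h11 : v = 1 := Subtype.ext h1
      rw [hk', h11]; rfl
    · exfalso
      have : ‖((v : Kˣ) : K) - 1‖ ≤ 1 / 4 := v.2
      rw [h1] at this
      have e : (((-1 : Kˣ) : K)) - 1 = -2 := by push_cast; ring
      rw [e, norm_neg, h2] at this
      norm_num at this
  have hfin : φ.range.index ≠ 0 := by
    have ex : ∀ q : Kˣ ⧸ φ.range, ∃ x : Kˣ, QuotientGroup.mk x = q ∧ 1/2 < ‖(x : K)‖ ∧ ‖(x : K)‖ ≤ 1 := by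
      intro q
      obtain ⟨x, rfl⟩ := QuotientGroup.mk_surjective q
      have hx0 : 0 < ‖(x : K)‖ := norm_pos_iff.mpr x.ne_zero
      obtain ⟨k, hk1, hk2⟩ := exists_mem_Ioc_zpow hx0 (y := 2) (by norm_num)
      refine ⟨x * two ^ (k + 1), ?_, ?_, ?_⟩
      · rw [eq_comm, QuotientGroup.eq]
        exact ⟨(Multiplicative.ofAdd (k + 1), 1), by rw [hφ]; simp⟩
      · rw [Units.val_mul, norm_mul, norm_two, one_div, inv_zpow', zpow_neg, ← div_eq_mul_inv,
          lt_div_iff₀ (by positivity), zpow_add₀ (by norm_num)]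
        rw [zpow_one]; linarith
      · rw [Units.val_mul, norm_mul, norm_two, one_div, inv_zpow', zpow_neg, ← div_eq_mul_inv,
          div_le_one₀ (by positivity)]
        exact hk2
    choose r hr1 hr2 hr3 using ex
    have : Finite (ballB K 1 zero_le_one ⧸ (ballB K (1/8) (by norm_num)).addSubgroupOf (ballB K 1 zero_le_one)) :=
      (AddSubgroup.finiteIndex_iff_finite_quotient).mp ⟨i3⟩
    let g : Kˣ ⧸ φ.range → (ballB K 1 zero_le_one ⧸ (ballB K (1/8) (by norm_num)).addSubgroupOf (ballB K 1 zero_le_one)) :=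
      fun q => QuotientAddGroup.mk ⟨(r q : K), hr3 q⟩
    have hg : Function.Injective g := by
      intro p q hpq
      have h := QuotientAddGroup.eq.mp hpq
      rw [AddSubgroup.mem_addSubgroupOf] at h
      have h' : ‖-(r p : K) + (r q : K)‖ ≤ 1 / 8 := h
      rw [← hr1 p, ← hr1 q, QuotientGroup.eq]
      have hmem : (r p)⁻¹ * r q ∈ V := by
        rw [hV, mem_unitV]
        have e : (((r p)⁻¹ * r q : Kˣ) : K) - 1 = (-(r p : K) + (r q : K)) / (r p : K) := by
          have := (r p).ne_zero
          push_cast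
          field_simp
          ring
        rw [e, norm_div, div_le_iff₀ (by linarith [hr2 p])]
        linarith [hr2 p]
      exact ⟨(1, ⟨_, hmem⟩), by rw [hφ]; simp⟩
    have : Finite (Kˣ ⧸ φ.range) := Finite.of_injective g hg
    exact Subgroup.index_ne_zero_of_finite
  have H := herbrand_index φ hinj hfin htors
  have hprod : (powMonoidHom 2 : Multiplicative ℤ × V →* Multiplicative ℤ × V).range =
      (powMonoidHom 2 : Multiplicative ℤ →* Multiplicative ℤ).range.prod
        (powMonoidHom 2 : V →* V).range := by
    ext ⟨k, v⟩
    rw [Subgroup.mem_prod]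
    constructor
    · rintro ⟨⟨a, b⟩, h⟩
      exact ⟨⟨a, congrArg Prod.fst h⟩, ⟨b, congrArg Prod.snd h⟩⟩
    · rintro ⟨⟨a, h1⟩, ⟨b, h2⟩⟩
      exact ⟨(a, b), Prod.ext h1 h2⟩
  have hVi : (powMonoidHom 2 : V →* V).range.index = 2 ^ m := by
    rw [hV, sq_range_unitV h2, ← i2, ← unitV_relIndex, Subgroup.relIndex]
  rw [hprod, Subgroup.index_prod, mult_int_sq_index, hVi, card_sq_ker K h20] at H
  rw [sqSubgroup, H]
  ring

end local_count

theorem field_index (K : Type*) [Field K] [Algebra ℚ_[2] K] [FiniteDimensional ℚ_[2] K] :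
    (sqSubgroup K).index = 2 ^ (Module.finrank ℚ_[2] K + 2) := by
  let _ : NormedField K := spectralNorm.normedField ℚ_[2] K
  have hnorm : ∀ x : K, ‖x‖ = spectralNorm ℚ_[2] K x := fun x => rfl
  have : CompleteSpace K := spectralNorm.completeSpace ℚ_[2] K
  have : IsUltrametricDist K :=
    IsUltrametricDist.isUltrametricDist_of_isNonarchimedean_norm (isNonarchimedean_spectralNorm (K := ℚ_[2]) (L := K))
  have h2 : ‖(2 : K)‖ = 1 / 2 := by
    have : (2 : K) = algebraMap ℚ_[2] K 2 := (map_ofNat _ 2).symm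
    rw [hnorm, this, spectralNorm_extends]
    have := Padic.norm_p (p := 2)
    simpa using this
  let _ : Algebra ℤ_[2] K := ((algebraMap ℚ_[2] K).comp (algebraMap ℤ_[2] ℚ_[2])).toAlgebra
  have : IsScalarTower ℤ_[2] ℚ_[2] K := IsScalarTower.of_algebraMap_eq fun _ => rfl
  have hint : ∀ x : K, ‖x‖ ≤ 1 ↔ IsIntegral ℤ_[2] x := by
    intro x
    have hx : IsIntegral ℚ_[2] x := Algebra.IsIntegral.isIntegral x
    rw [hnorm, spectralNorm, spectralValue_le_one_iff (minpoly.monic hx)]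
    constructor
    · intro h
      have hl : minpoly ℚ_[2] x ∈ Polynomial.lifts (algebraMap ℤ_[2] ℚ_[2]) := by
        rw [Polynomial.lifts_iff_coeff_lifts]
        intro n
        exact ⟨⟨_, h n⟩, rfl⟩
      obtain ⟨q, hq, -, hqm⟩ := Polynomial.lifts_and_degree_eq_and_monic hl (minpoly.monic hx)
      refine ⟨q, hqm, ?_⟩
      have := minpoly.aeval ℚ_[2] x
      rw [← hq, Polynomial.aeval_map_algebraMap] at this
      exact this
    · intro h n
      rw [minpoly.isIntegrallyClosed_eq_field_fractions' ℚ_[2] h, Polynomial.coeff_map]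
      exact ((minpoly ℤ_[2] x).coeff n).2
  refine local_index h2 _ ?_
  let C := integralClosure ℤ_[2] K
  have : Module.IsTorsionFree ℤ_[2] K := Module.IsTorsionFree.trans_faithfulSMul ℤ_[2] ℚ_[2] K
  have : Module.Free ℤ_[2] C := IsIntegralClosure.module_free ℤ_[2] ℚ_[2] K C
  have : Module.Finite ℤ_[2] C := IsIntegralClosure.finite ℤ_[2] ℚ_[2] K C
  have hrank : Module.finrank ℤ_[2] C = Module.finrank ℚ_[2] K := IsIntegralClosure.rank ℤ_[2] ℚ_[2] K C
  let b := Module.finBasis ℤ_[2] C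
  let ψ : C →+ K := C.val.toRingHom.toAddMonoidHom
  have hψ : Function.Injective ψ := Subtype.val_injective
  have hψ1 : ballB K 1 (by norm_num) = AddSubgroup.map ψ ⊤ := by
    ext x
    rw [mem_ballB, hint]
    constructor
    · intro h
      exact ⟨⟨x, h⟩, trivial, rfl⟩
    · rintro ⟨y, -, rfl⟩
      exact y.2
  have h20 : (2 : K) ≠ 0 := by intro h; rw [h, norm_zero] at h2; norm_num at h2
  have hψ2 : ballB K (1/2) (by norm_num) = AddSubgroup.map ψ (nsmulAddMonoidHom 2 : C →+ C).range := by
    ext x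
    rw [mem_ballB]
    constructor
    · intro h
      have : ‖x / 2‖ ≤ 1 := by rw [norm_div, h2]; linarith
      rw [hint] at this
      refine ⟨_, ⟨⟨x / 2, this⟩, rfl⟩, ?_⟩
      change ((2 • (⟨x / 2, this⟩ : C) : C) : K) = x
      rw [two_nsmul]
      change x / 2 + x / 2 = x
      field_simp; ring
    · rintro ⟨_, ⟨y, rfl⟩, rfl⟩
      have hy : ‖(y : K)‖ ≤ 1 := (hint _).mpr y.2
      have : ψ (nsmulAddMonoidHom 2 y) = 2 * (y : K) := by
        change ((2 • y : C) : K) = _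
        rw [two_nsmul, two_mul]
        rfl
      rw [this, norm_mul, h2]; linarith
  rw [hψ1, hψ2, AddSubgroup.relIndex_map_map_of_injective _ _ hψ, AddSubgroup.relIndex_top_right]
  have hZ : (nsmulAddMonoidHom 2 : ℤ_[2] →+ ℤ_[2]).range.index = 2 := by
    have e : (nsmulAddMonoidHom 2 : ℤ_[2] →+ ℤ_[2]).range = (PadicInt.toZMod (p := 2)).toAddMonoidHom.ker := by
      ext x
      have : x ∈ (PadicInt.toZMod (p := 2)).toAddMonoidHom.ker ↔ x ∈ RingHom.ker (PadicInt.toZMod (p := 2)) := Iff.rfl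
      rw [this, PadicInt.ker_toZMod, PadicInt.maximalIdeal_eq_span_p, Ideal.mem_span_singleton]
      constructor
      · rintro ⟨y, rfl⟩
        exact ⟨y, by simp⟩
      · rintro ⟨y, rfl⟩
        exact ⟨y, by simp⟩
    rw [e, AddSubgroup.index_ker, AddMonoidHom.range_eq_top.mpr (ZMod.ringHom_surjective (PadicInt.toZMod (p := 2)))]
    simp
  let eqv : C ≃+ (Fin (Module.finrank ℤ_[2] C) → ℤ_[2]) := b.equivFun.toAddEquiv
  have hpi : AddSubgroup.map eqv.toAddMonoidHom (nsmulAddMonoidHom 2 : C →+ C).range =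
      AddSubgroup.pi Set.univ (fun _ => (nsmulAddMonoidHom 2 : ℤ_[2] →+ ℤ_[2]).range) := by
    ext x
    rw [AddSubgroup.mem_pi]
    constructor
    · rintro ⟨_, ⟨y, rfl⟩, rfl⟩ i -
      refine ⟨eqv y i, ?_⟩
      change 2 • eqv y i = eqv (2 • y) i
      rw [map_nsmul]; rfl
    · intro h
      choose y hy using fun i => h i trivial
      refine ⟨_, ⟨eqv.symm y, rfl⟩, ?_⟩
      change eqv (2 • eqv.symm y) = x
      rw [map_nsmul, AddEquiv.apply_symm_apply]
      exact funext hy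
  rw [← AddSubgroup.index_map_equiv _ eqv]
  refine (congrArg AddSubgroup.index hpi).trans ?_
  rw [AddSubgroup.index_pi]
  simp [hZ, hrank]

section quad

/-- The data of a quadratic extension with its conjugation. -/
structure QuadData (F K : Type*) [Field F] [Field K] [Algebra F K] (σ : K ≃ₐ[F] K) : Prop where
  norm_eq : ∀ x : K, algebraMap F K (Algebra.norm F x) = x * σ x
  fixed : ∀ x : K, σ x = x → ∃ y : F, algebraMap F K y = x
  invol : ∀ x : K, σ (σ x) = x

theorem quad_exists (F K : Type*) [Field F] [CharZero F] [Field K] [Algebra F K]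
    (h : Module.finrank F K = 2) : ∃ σ : K ≃ₐ[F] K, QuadData F K σ := by
  have : FiniteDimensional F K := FiniteDimensional.of_finrank_pos (by omega)
  have : Algebra.IsQuadraticExtension F K := ⟨h⟩
  have hc : Nat.card (K ≃ₐ[F] K) = 2 := (IsGalois.card_aut_eq_finrank F K).trans h
  obtain ⟨σ, hσ, huniq⟩ := (Nat.card_eq_two_iff' (1 : K ≃ₐ[F] K)).mp hc
  have hall : ∀ g : K ≃ₐ[F] K, g = 1 ∨ g = σ := fun g => by
    by_cases hg : g = 1
    · exact Or.inl hg
    · exact Or.inr (huniq g hg)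
  refine ⟨σ, ?_, ?_, ?_⟩
  · intro x
    classical
    rw [Algebra.norm_eq_prod_automorphisms]
    have : (Finset.univ : Finset (K ≃ₐ[F] K)) = {1, σ} := by
      ext g
      simpa using hall g
    rw [this, Finset.prod_pair (Ne.symm hσ)]
    rfl
  · intro x hx
    have := (IsGalois.mem_bot_iff_fixed (F := F) x).mpr (fun g => by
      rcases hall g with rfl | rfl
      · rfl
      · exact hx)
    exact IntermediateField.mem_bot.mp this
  · intro x
    have : σ * σ = 1 := by
      rcases hall (σ * σ) with h1 | h1
      · exact h1
      · exact absurd (mul_eq_left.mp h1) hσ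
    exact DFunLike.congr_fun this x

variable {F K : Type*} [Field F] [CharZero F] [Field K] [Algebra F K] {σ : K ≃ₐ[F] K}

theorem quad_gen (h : Module.finrank F K = 2) :
    ∃ δ : K, (¬ ∃ y : F, algebraMap F K y = δ) ∧ ∃ d : F, algebraMap F K d = δ ^ 2 := by
  have : CharZero K := charZero_of_injective_algebraMap (algebraMap F K).injective
  obtain ⟨σ, hσ⟩ := quad_exists F K h
  have hx : ∃ x : K, σ x ≠ x := by
    by_contra! hcon
    have hb : (⊥ : Subalgebra F K) = ⊤ := by
      rw [eq_top_iff]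
      intro x _
      exact Algebra.mem_bot.mpr (hσ.fixed x (hcon x))
    have := Subalgebra.bot_eq_top_iff_finrank_eq_one.mp hb
    omega
  obtain ⟨x, hx⟩ := hx
  have hs : σ (x - σ x) = -(x - σ x) := by rw [map_sub, hσ.invol]; ring
  refine ⟨x - σ x, ?_, hσ.fixed _ (by rw [map_pow, hs]; ring)⟩
  rintro ⟨y, hy⟩
  rw [← hy, AlgEquiv.commutes, hy] at hs
  apply hx
  have : (2 : K) * (x - σ x) = 0 := by linear_combination hs
  have := (mul_eq_zero.mp this).resolve_left two_ne_zero
  exact (sub_eq_zero.mp this).symm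

theorem quad_conj (hσ : QuadData F K σ) {δ : K} (h1 : ¬ ∃ y : F, algebraMap F K y = δ)
    {d : F} (h2 : algebraMap F K d = δ ^ 2) : σ δ = -δ := by
  have : (σ δ) ^ 2 = δ ^ 2 := by rw [← map_pow, ← h2, AlgEquiv.commutes]
  rcases sq_eq_sq_iff_eq_or_eq_neg.mp this with h | h
  · exact absurd (hσ.fixed _ h) h1
  · exact h

/-- base change of square classes -/
noncomputable def baseSq (F K : Type*) [Field F] [Field K] [Algebra F K] :
    Fˣ ⧸ sqSubgroup F →* Kˣ ⧸ sqSubgroup K :=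
  QuotientGroup.map _ _ (Units.map (algebraMap F K : F →* K)) (by
    rintro x ⟨y, rfl⟩
    exact ⟨Units.map (algebraMap F K : F →* K) y, by
      simp [powMonoidHom_apply, map_pow]⟩)

theorem ker_normSq_eq (h : Module.finrank F K = 2) :
    (normSqClasses F K).ker = (baseSq F K).range := by
  have : CharZero K := charZero_of_injective_algebraMap (algebraMap F K).injective
  obtain ⟨σ, hσ⟩ := quad_exists F K h
  obtain ⟨δ, hδ1, d, hδ2⟩ := quad_gen h
  have hconj := quad_conj hσ hδ1 hδ2
  have hδ0 : δ ≠ 0 := by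
    rintro rfl
    exact hδ1 ⟨0, map_zero _⟩
  ext q
  obtain ⟨x, rfl⟩ := QuotientGroup.mk_surjective q
  rw [MonoidHom.mem_ker]
  constructor
  · intro hx
    have hx' := (QuotientGroup.eq_one_iff _).mp hx
    obtain ⟨c, hc⟩ := hx'
    have hc' : (c : F) ^ 2 = Algebra.norm F (x : K) := congrArg Units.val hc
    have hN := hσ.norm_eq x
    rw [← hc', map_pow] at hN
    have hc0 : algebraMap F K c ≠ 0 := by simp
    -- z has norm one
    obtain ⟨y, hy0, hy⟩ : ∃ y : K, y ≠ 0 ∧ (x : K) * σ y = algebraMap F K c * y := by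
      by_cases hz : algebraMap F K c + x = 0
      · refine ⟨δ, hδ0, ?_⟩
        rw [hconj]
        linear_combination (-δ) * hz
      · refine ⟨algebraMap F K c + x, hz, ?_⟩
        rw [map_add, AlgEquiv.commutes]
        linear_combination -hN
    refine ⟨QuotientGroup.mk (c * (Units.map (Algebra.norm F : K →* F) (Units.mk0 y hy0))), ?_⟩
    change QuotientGroup.mk (Units.map (algebraMap F K : F →* K) _) = _
    rw [QuotientGroup.eq]
    have hsy : σ y ≠ 0 := by simpa using hy0
    refine ⟨Units.mk0 (σ y)⁻¹ (inv_ne_zero hsy), ?_⟩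
    apply Units.ext
    rw [Units.val_mul, Units.val_inv_eq_inv_val]
    change ((σ y)⁻¹) ^ 2 = (algebraMap F K (c * Algebra.norm F y))⁻¹ * x
    rw [map_mul, hσ.norm_eq]
    field_simp
    linear_combination -hy
  · rintro ⟨p, hp⟩
    obtain ⟨c, rfl⟩ := QuotientGroup.mk_surjective p
    rw [← hp]
    change QuotientGroup.mk (Units.map (Algebra.norm F : K →* F) (Units.map (algebraMap F K : F →* K) c)) = 1
    rw [QuotientGroup.eq_one_iff]
    refine ⟨c, Units.ext ?_⟩
    change (c : F) ^ 2 = Algebra.norm F (algebraMap F K c)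
    rw [Algebra.norm_algebraMap, h]

theorem card_ker_baseSq (h : Module.finrank F K = 2) : Nat.card (baseSq F K).ker = 2 := by
  have : CharZero K := charZero_of_injective_algebraMap (algebraMap F K).injective
  obtain ⟨σ, hσ⟩ := quad_exists F K h
  obtain ⟨δ, hδ1, d, hδ2⟩ := quad_gen h
  have hconj := quad_conj hσ hδ1 hδ2
  have hδ0 : δ ≠ 0 := by
    rintro rfl
    exact hδ1 ⟨0, map_zero _⟩
  have hd0 : d ≠ 0 := by
    rintro rfl
    rw [map_zero] at hδ2
    exact hδ0 (pow_eq_zero_iff (two_ne_zero) |>.mp hδ2.symm)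
  let d' : Fˣ ⧸ sqSubgroup F := QuotientGroup.mk (Units.mk0 d hd0)
  have hd' : (1 : Fˣ ⧸ sqSubgroup F) ≠ d' := by
    intro hcon
    obtain ⟨s, hs⟩ := (QuotientGroup.eq_one_iff _).mp hcon.symm
    have hs' : (s : F) ^ 2 = d := congrArg Units.val hs
    rw [← hs', map_pow] at hδ2
    rcases sq_eq_sq_iff_eq_or_eq_neg.mp hδ2 with h1 | h1
    · exact hδ1 ⟨_, h1⟩
    · exact hδ1 ⟨-s, by rw [map_neg, h1, neg_neg]⟩
  have : ((baseSq F K).ker : Set (Fˣ ⧸ sqSubgroup F)) = {1, d'} := by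
    ext q
    obtain ⟨x, rfl⟩ := QuotientGroup.mk_surjective q
    rw [SetLike.mem_coe, MonoidHom.mem_ker]
    constructor
    · intro hx
      obtain ⟨y, hy⟩ := (QuotientGroup.eq_one_iff _).mp hx
      have hy' : (y : K) ^ 2 = algebraMap F K x := congrArg Units.val hy
      have hsq : (σ (y : K)) ^ 2 = (y : K) ^ 2 := by rw [← map_pow, hy', AlgEquiv.commutes]
      rcases sq_eq_sq_iff_eq_or_eq_neg.mp hsq with h1 | h1
      · left
        obtain ⟨u, hu⟩ := hσ.fixed _ h1
        have hu2 : u ^ 2 = x := (algebraMap F K).injective (by rw [map_pow, hu, hy'])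
        have hu0 : u ≠ 0 := by
          rintro rfl
          exact x.ne_zero (by rw [← hu2]; simp)
        rw [QuotientGroup.eq_one_iff]
        exact ⟨Units.mk0 u hu0, Units.ext hu2⟩
      · right
        obtain ⟨u, hu⟩ := hσ.fixed ((y : K) * δ) (by rw [map_mul, h1, hconj]; ring)
        have hu2 : u ^ 2 = x * d := (algebraMap F K).injective (by
          rw [map_pow, hu, map_mul, ← hy', hδ2]; ring)
        have hu0 : u ≠ 0 := by
          rintro rfl
          apply mul_ne_zero x.ne_zero hd0
          rw [← hu2]; simp
        rw [Set.mem_singleton_iff, QuotientGroup.eq]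
        refine ⟨Units.mk0 (u / x) (div_ne_zero hu0 x.ne_zero), Units.ext ?_⟩
        rw [Units.val_mul, Units.val_inv_eq_inv_val]
        change (u / x) ^ 2 = (x : F)⁻¹ * d
        rw [div_pow, hu2]
        have := x.ne_zero
        field_simp
    · rintro (h1 | h1)
      · rw [h1]; exact map_one _
      · rw [h1]
        change QuotientGroup.mk (Units.map (algebraMap F K : F →* K) (Units.mk0 d hd0)) = _
        rw [QuotientGroup.eq_one_iff]
        exact ⟨Units.mk0 δ hδ0, Units.ext hδ2.symm⟩
  change Nat.card ((baseSq F K).ker : Set (Fˣ ⧸ sqSubgroup F)) = 2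
  rw [this, Nat.card_coe_set_eq, Set.ncard_pair hd']

theorem card_ker_normSq (h : Module.finrank F K = 2) :
    Nat.card (normSqClasses F K).ker * 2 = (sqSubgroup F).index := by
  rw [ker_normSq_eq h, ← Subgroup.index_ker, ← card_ker_baseSq h, mul_comm,
    Subgroup.card_mul_index]
  rfl

theorem index_range_normSq (h : Module.finrank F K = 2) (n : ℕ)
    (hF : (sqSubgroup F).index = 2 ^ (n + 2)) (hK : (sqSubgroup K).index = 2 ^ (2 * n + 2)) :
    (normSqClasses F K).range.index = 2 := by
  have h1 := card_ker_normSq (F := F) (K := K) h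
  have h2 := (normSqClasses F K).ker.card_mul_index
  rw [Subgroup.index_ker] at h2
  have h3 := (normSqClasses F K).range.card_mul_index
  have hF' : Nat.card (Fˣ ⧸ sqSubgroup F) = 2 ^ (n + 2) := hF
  have hK' : Nat.card (Kˣ ⧸ sqSubgroup K) = 2 ^ (2 * n + 2) := hK
  rw [hF'] at h3
  rw [hK'] at h2
  rw [hF] at h1
  have h4 : Nat.card (normSqClasses F K).ker = 2 ^ (n + 1) := by
    have : (2 : ℕ) ^ (n + 2) = 2 ^ (n + 1) * 2 := by ring
    omega
  have h5 : Nat.card (normSqClasses F K).range = 2 ^ (n + 1) := by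
    rw [h4] at h2
    have : (2 : ℕ) ^ (2 * n + 2) = 2 ^ (n + 1) * 2 ^ (n + 1) := by ring
    rw [this] at h2
    exact Nat.eq_of_mul_eq_mul_left (by positivity) h2
  rw [h5] at h3
  apply Nat.eq_of_mul_eq_mul_left (show 0 < 2 ^ (n + 1) by positivity)
  rw [h3]; ring

/-- `c` is represented by `u² - d v²`. -/
def RepBy {F : Type*} [Field F] (c d : F) : Prop := ∃ u v : F, c = u ^ 2 - d * v ^ 2

theorem RepBy.symm {c d : F} (hc : c ≠ 0) (h : RepBy c d) : RepBy d c := by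
  obtain ⟨u, v, h⟩ := h
  by_cases hv : v = 0
  · subst hv
    have hu : u ≠ 0 := by rintro rfl; simp [h] at hc
    refine ⟨(d + 1) / 2, (d - 1) / (2 * u), ?_⟩
    rw [h]; field_simp; ring
  · refine ⟨u / v, 1 / v, ?_⟩
    rw [h]; field_simp; ring

theorem repBy_sq (x s : F) (hs : s ≠ 0) : RepBy x (s ^ 2) :=
  ⟨(x + 1) / 2, (x - 1) / (2 * s), by field_simp; ring⟩

theorem mem_range_iff_repBy (h : Module.finrank F K = 2) {δ : K}
    (h1 : ¬ ∃ y : F, algebraMap F K y = δ) {d : F} (h2 : algebraMap F K d = δ ^ 2) (c : Fˣ) :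
    (QuotientGroup.mk c : Fˣ ⧸ sqSubgroup F) ∈ (normSqClasses F K).range ↔ RepBy (c : F) d := by
  have : CharZero K := charZero_of_injective_algebraMap (algebraMap F K).injective
  obtain ⟨σ, hσ⟩ := quad_exists F K h
  have hconj := quad_conj hσ h1 h2
  have hδ0 : δ ≠ 0 := by
    rintro rfl
    exact h1 ⟨0, map_zero _⟩
  have hN : ∀ u v : F, Algebra.norm F (algebraMap F K u + algebraMap F K v * δ) =
      u ^ 2 - d * v ^ 2 := by
    intro u v
    apply (algebraMap F K).injective
    rw [hσ.norm_eq]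
    simp only [map_add, map_mul, AlgEquiv.commutes, hconj, map_sub, map_pow, h2]
    ring
  constructor
  · rintro ⟨q, hq⟩
    obtain ⟨x, rfl⟩ := QuotientGroup.mk_surjective q
    obtain ⟨s, hs⟩ := QuotientGroup.eq.mp hq
    have hs' : (s : F) ^ 2 = (Algebra.norm F (x : K))⁻¹ * c := by
      have := congrArg Units.val hs
      rw [Units.val_mul, Units.val_inv_eq_inv_val] at this
      exact this
    have hx0 : Algebra.norm F (x : K) ≠ 0 := (Units.map (Algebra.norm F : K →* F) x).ne_zero
    obtain ⟨u, hu⟩ := hσ.fixed (((x : K) + σ x) / 2) (by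
      rw [map_div₀, map_add, hσ.invol, map_ofNat]; ring)
    obtain ⟨v, hv⟩ := hσ.fixed (((x : K) - σ x) / (2 * δ)) (by
      rw [map_div₀, map_sub, hσ.invol, map_mul, map_ofNat, hconj]; field_simp; ring)
    have hxx : (x : K) = algebraMap F K u + algebraMap F K v * δ := by
      rw [hu, hv]; field_simp; ring
    have hNx : Algebra.norm F (x : K) = u ^ 2 - d * v ^ 2 := by rw [hxx, hN]
    refine ⟨u * s, v * s, ?_⟩
    have : (c : F) = Algebra.norm F (x : K) * s ^ 2 := by
      rw [hs']; field_simp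
    rw [this, hNx]; ring
  · rintro ⟨u, v, huv⟩
    have hx0 : algebraMap F K u + algebraMap F K v * δ ≠ 0 := by
      intro h0
      have : FiniteDimensional F K := FiniteDimensional.of_finrank_pos (by omega)
      have := hN u v
      rw [h0, ← huv, Algebra.norm_zero] at this
      exact c.ne_zero this.symm
    refine ⟨QuotientGroup.mk (Units.mk0 _ hx0), ?_⟩
    change QuotientGroup.mk (Units.map (Algebra.norm F : K →* F) (Units.mk0 _ hx0)) = _
    congr 1
    apply Units.ext
    rw [huv]
    exact hN u v

end quad

section hilbert
variable {F : Type*} [Field F] [Algebra ℚ_[2] F] [FiniteDimensional ℚ_[2] F]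

theorem index_quad (K : Type*) [Field K] [Algebra F K] (h : Module.finrank F K = 2) :
    (sqSubgroup K).index = 2 ^ (2 * Module.finrank ℚ_[2] F + 2) := by
  have : FiniteDimensional F K := FiniteDimensional.of_finrank_pos (by omega)
  let _ : Algebra ℚ_[2] K := ((algebraMap F K).comp (algebraMap ℚ_[2] F)).toAlgebra
  have : IsScalarTower ℚ_[2] F K := IsScalarTower.of_algebraMap_eq fun _ => rfl
  have : FiniteDimensional ℚ_[2] K := FiniteDimensional.trans ℚ_[2] F K
  rw [field_index K, ← Module.finrank_mul_finrank ℚ_[2] F K, h, mul_comm]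

theorem charZero_local (F : Type*) [Field F] [Algebra ℚ_[2] F] : CharZero F :=
  charZero_of_injective_algebraMap (algebraMap ℚ_[2] F).injective

theorem range_index_two {K : Type*} [Field K] [Algebra F K] (h : Module.finrank F K = 2) :
    (normSqClasses F K).range.index = 2 := by
  have := charZero_local F
  exact index_range_normSq h _ (field_index F) (index_quad K h)

theorem exists_quad.{u} {F : Type u} [Field F] (c : F) (hc : ¬ ∃ s : F, s ^ 2 = c) :
    ∃ (K : Type u) (_ : Field K) (_ : Algebra F K), Module.finrank F K = 2 ∧ ∃ δ : K,
      (¬ ∃ y : F, algebraMap F K y = δ) ∧ algebraMap F K c = δ ^ 2 := by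
  let p : Polynomial F := Polynomial.X ^ 2 - Polynomial.C c
  have hp : Irreducible p := by
    refine X_pow_sub_C_irreducible_of_prime Nat.prime_two ?_
    intro b hb
    exact hc ⟨b, hb⟩
  have : Fact (Irreducible p) := ⟨hp⟩
  have hroot : algebraMap F (AdjoinRoot p) c = (AdjoinRoot.root p) ^ 2 := by
    have := AdjoinRoot.eval₂_root p
    simp only [p, Polynomial.eval₂_sub, Polynomial.eval₂_pow, Polynomial.eval₂_X,
      Polynomial.eval₂_C] at this
    exact (sub_eq_zero.mp this).symm
  refine ⟨AdjoinRoot p, inferInstance, inferInstance, ?_, AdjoinRoot.root p, ?_, hroot⟩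
  · rw [(AdjoinRoot.powerBasis hp.ne_zero).finrank, AdjoinRoot.powerBasis_dim]
    exact Polynomial.natDegree_X_pow_sub_C
  · rintro ⟨y, hy⟩
    rw [← hy, ← map_pow] at hroot
    exact hc ⟨y, ((algebraMap F (AdjoinRoot p)).injective hroot).symm⟩

theorem repBy_mul (x y c : F) (hx : x ≠ 0) (hy : y ≠ 0) (hc : c ≠ 0) :
    RepBy (x * y) c ↔ (RepBy x c ↔ RepBy y c) := by
  have := charZero_local F
  by_cases hs : ∃ s : F, s ^ 2 = c
  · obtain ⟨s, rfl⟩ := hs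
    have hs0 : s ≠ 0 := by rintro rfl; simp at hc
    simp [repBy_sq _ s hs0]
  · obtain ⟨K, _, _, h, δ, h1, h2⟩ := exists_quad c hs
    have := Subgroup.mul_mem_iff_of_index_two (range_index_two (F := F) (K := K) h)
      (a := QuotientGroup.mk (Units.mk0 x hx)) (b := QuotientGroup.mk (Units.mk0 y hy))
    rw [← QuotientGroup.mk_mul, mem_range_iff_repBy h h1 h2, mem_range_iff_repBy h h1 h2,
      mem_range_iff_repBy h h1 h2] at this
    exact this

theorem base_le_range {K E : Type*} [Field K] [Field E] [Algebra F K] [Algebra K E]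
    (hFK : Module.finrank F K = 2) (hKE : Module.finrank K E = 2)
    {α : K} {a : F} (hα1 : ¬ ∃ y : F, algebraMap F K y = α) (hα : algebraMap F K a = α ^ 2)
    {β : E} {b : F} (hβ1 : ¬ ∃ y : K, algebraMap K E y = β)
    (hβ : algebraMap K E (algebraMap F K b) = β ^ 2) :
    (baseSq F K).range ≤ (normSqClasses K E).range := by
  have := charZero_local F
  have : CharZero K := charZero_of_injective_algebraMap (algebraMap F K).injective
  have hα0 : α ≠ 0 := by
    rintro rfl
    exact hα1 ⟨0, map_zero _⟩
  have hβ0 : β ≠ 0 := by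
    rintro rfl
    exact hβ1 ⟨0, map_zero _⟩
  have ha0 : a ≠ 0 := by
    rintro rfl
    rw [map_zero] at hα
    exact hα0 (pow_eq_zero_iff (two_ne_zero) |>.mp hα.symm)
  have hb0 : b ≠ 0 := by
    rintro rfl
    rw [map_zero, map_zero] at hβ
    exact hβ0 (pow_eq_zero_iff (two_ne_zero) |>.mp hβ.symm)
  have key1 : ∀ c : Fˣ, RepBy (c : F) b → baseSq F K (QuotientGroup.mk c) ∈ (normSqClasses K E).range := by
    rintro c ⟨u, v, h⟩
    change QuotientGroup.mk (Units.map (algebraMap F K : F →* K) c) ∈ _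
    rw [mem_range_iff_repBy hKE hβ1 hβ]
    refine ⟨algebraMap F K u, algebraMap F K v, ?_⟩
    change algebraMap F K c = _
    rw [h]; simp
  have key2 : ∀ c : Fˣ, RepBy (c : F) (a * b) → baseSq F K (QuotientGroup.mk c) ∈ (normSqClasses K E).range := by
    rintro c ⟨u, v, h⟩
    change QuotientGroup.mk (Units.map (algebraMap F K : F →* K) c) ∈ _
    rw [mem_range_iff_repBy hKE hβ1 hβ]
    refine ⟨algebraMap F K u, α * algebraMap F K v, ?_⟩
    change algebraMap F K c = _
    rw [h]; simp only [map_sub, map_mul, map_pow, hα]; ring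
  -- a unit which is not a norm
  obtain ⟨c₀, hc₀⟩ : ∃ c : Fˣ, ¬ RepBy (c : F) a := by
    by_contra! hcon
    have : (normSqClasses F K).range = ⊤ := by
      rw [eq_top_iff]
      intro q _
      obtain ⟨x, rfl⟩ := QuotientGroup.mk_surjective q
      rw [mem_range_iff_repBy hFK hα1 hα]
      exact hcon x
    have h2 := range_index_two (F := F) (K := K) hFK
    rw [this, Subgroup.index_top] at h2
    omega
  have hs : ∀ (c : Fˣ) (d : F), d ≠ 0 → (RepBy (c : F) d ↔ RepBy d (c : F)) := fun c d hd =>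
    ⟨fun h => h.symm c.ne_zero, fun h => h.symm hd⟩
  have hx : RepBy (c₀ : F) (a * b) ↔ ¬ RepBy (c₀ : F) b := by
    rw [hs _ _ (mul_ne_zero ha0 hb0), repBy_mul a b c₀ ha0 hb0 c₀.ne_zero, ← hs _ _ ha0, ← hs _ _ hb0]
    tauto
  have hprod : ∀ c : Fˣ, baseSq F K (QuotientGroup.mk c₀) ∈ (normSqClasses K E).range →
      baseSq F K (QuotientGroup.mk (c * c₀)) ∈ (normSqClasses K E).range →
      baseSq F K (QuotientGroup.mk c) ∈ (normSqClasses K E).range := by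
    intro c h1 h2
    rw [QuotientGroup.mk_mul, map_mul] at h2
    exact (Subgroup.mul_mem_cancel_right _ h1).mp h2
  rintro _ ⟨q, rfl⟩
  obtain ⟨c, rfl⟩ := QuotientGroup.mk_surjective q
  by_cases hb : RepBy (c : F) b
  · exact key1 c hb
  by_cases hab : RepBy (c : F) (a * b)
  · exact key2 c hab
  by_cases h0 : RepBy (c₀ : F) b
  · refine hprod c (key1 _ h0) (key2 _ ?_)
    rw [Units.val_mul, repBy_mul _ _ _ c.ne_zero c₀.ne_zero (mul_ne_zero ha0 hb0)]
    tauto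
  · refine hprod c (key2 _ (hx.mpr h0)) (key1 _ ?_)
    rw [Units.val_mul, repBy_mul _ _ _ c.ne_zero c₀.ne_zero hb0]
    tauto

theorem card_ker_comp {A B C : Type*} [Group A] [Group B] [Group C] (f : A →* B)
    (g : B →* C) (h : g.ker ≤ f.range) :
    Nat.card (g.comp f).ker = Nat.card f.ker * Nat.card g.ker := by
  rw [← MonoidHom.comap_ker]
  have h1 := Subgroup.relIndex_mul_relIndex ⊥ f.ker (g.ker.comap f) bot_le (by
    intro x hx
    rw [Subgroup.mem_comap, MonoidHom.mem_ker.mp hx]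
    exact one_mem _)
  rw [Subgroup.relIndex_bot_left, Subgroup.relIndex_bot_left] at h1
  rw [← h1]
  congr 1
  have : f.ker = (⊥ : Subgroup B).comap f := rfl
  rw [this, Subgroup.relIndex_comap, Subgroup.map_comap_eq, inf_eq_right.mpr h,
    Subgroup.relIndex_bot_left]

theorem tower_count {K E : Type*} [Field K] [Field E] [Algebra F K] [Algebra K E] [Algebra F E]
    [IsScalarTower F K E]
    (hFK : Module.finrank F K = 2) (hKE : Module.finrank K E = 2)
    {α : K} {a : F} (hα1 : ¬ ∃ y : F, algebraMap F K y = α) (hα : algebraMap F K a = α ^ 2)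
    {β : E} {b : F} (hβ1 : ¬ ∃ y : K, algebraMap K E y = β)
    (hβ : algebraMap K E (algebraMap F K b) = β ^ 2) :
    Nat.card (normSqClasses F E).ker = 2 ^ (3 * Module.finrank ℚ_[2] F + 2) := by
  have := charZero_local F
  have : CharZero K := charZero_of_injective_algebraMap (algebraMap F K).injective
  have : FiniteDimensional F K := FiniteDimensional.of_finrank_pos (by omega)
  have : FiniteDimensional K E := FiniteDimensional.of_finrank_pos (by omega)
  have hcomp : normSqClasses F E = (normSqClasses F K).comp (normSqClasses K E) := by
    ext x
    change QuotientGroup.mk (Units.map (Algebra.norm F : E →* F) x) =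
      (QuotientGroup.mk (Units.map (Algebra.norm F : K →* F) (Units.map (Algebra.norm K : E →* K) x)) : Fˣ ⧸ sqSubgroup F)
    congr 1
    apply Units.ext
    exact (Algebra.norm_norm (R := F) (S := K) (A := E)).symm
  rw [hcomp, card_ker_comp _ _ (by
    rw [ker_normSq_eq hFK]
    exact base_le_range hFK hKE hα1 hα hβ1 hβ)]
  have h1 := card_ker_normSq (F := F) (K := K) hFK
  have h2 := card_ker_normSq (F := K) (K := E) hKE
  rw [field_index F] at h1
  rw [index_quad (F := F) K hFK] at h2
  set n := Module.finrank ℚ_[2] F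
  have e1 : (2 : ℕ) ^ (n + 2) = 2 ^ (n + 1) * 2 := by ring
  have e2 : (2 : ℕ) ^ (2 * n + 2) = 2 ^ (2 * n + 1) * 2 := by ring
  rw [Nat.eq_of_mul_eq_mul_right two_pos (h1.trans e1),
    Nat.eq_of_mul_eq_mul_right two_pos (h2.trans e2)]
  ring

end hilbert

/-- F/ℚ₂ finite of degree n, E/F Galois with group (ℤ/2ℤ)².  Then the
kernel of the induced norm map E×/(E×)² → F×/(F×)² has order 2^(3n+2). -/
theorem stmt_9 (F E : Type*) [Field F] [Field E] [Algebra ℚ_[2] F]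
    [FiniteDimensional ℚ_[2] F] (n : ℕ) (hn : Module.finrank ℚ_[2] F = n)
    [Algebra F E] [FiniteDimensional F E] [IsGalois F E]
    (e : (E ≃ₐ[F] E) ≃* Multiplicative (ZMod 2 × ZMod 2)) :
    Nat.card (normSqClasses F E).ker = 2 ^ (3 * n + 2) := by
  have := charZero_local F
  subst hn
  set σ : E ≃ₐ[F] E := e.symm (Multiplicative.ofAdd (1, 0)) with hσ
  set τ : E ≃ₐ[F] E := e.symm (Multiplicative.ofAdd (0, 1)) with hτ
  have hcard : Module.finrank F E = 4 := by
    rw [← IsGalois.card_aut_eq_finrank F E, Nat.card_congr e.toEquiv]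
    simp [Nat.card_prod]
  have hord : ∀ z : Multiplicative (ZMod 2 × ZMod 2), z ≠ 1 → orderOf (e.symm z) = 2 := by
    intro z hz
    rw [MulEquiv.orderOf_eq e.symm z]
    refine orderOf_eq_prime ?_ hz
    revert z
    decide
  have hσ2 : orderOf σ = 2 := hord _ (by decide)
  have hτ2 : orderOf τ = 2 := hord _ (by decide)
  have hfix : ∀ x : E, σ x = x → τ x = x → ∃ y : F, algebraMap F E y = x := by
    intro x h1 h2
    apply IntermediateField.mem_bot.mp
    rw [IsGalois.mem_bot_iff_fixed]
    intro g
    have hg : g = 1 ∨ g = σ ∨ g = τ ∨ g = σ * τ := by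
      have hz : ∀ z : Multiplicative (ZMod 2 × ZMod 2), z = 1 ∨ z = Multiplicative.ofAdd (1, 0) ∨
          z = Multiplicative.ofAdd (0, 1) ∨
          z = Multiplicative.ofAdd (1, 0) * Multiplicative.ofAdd (0, 1) := by decide
      rw [hσ, hτ, ← map_mul]
      rw [← e.symm_apply_apply g]
      rcases hz (e g) with h | h | h | h <;> rw [h] <;> simp
    rcases hg with rfl | rfl | rfl | rfl
    · rfl
    · exact h1
    · exact h2
    · rw [AlgEquiv.mul_apply, h2, h1]
  let K := IntermediateField.fixedField (Subgroup.zpowers σ)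
  let L := IntermediateField.fixedField (Subgroup.zpowers τ)
  have hKE : Module.finrank K E = 2 := by
    rw [IntermediateField.finrank_fixedField_eq_card, Nat.card_zpowers, hσ2]
  have hLE : Module.finrank L E = 2 := by
    rw [IntermediateField.finrank_fixedField_eq_card, Nat.card_zpowers, hτ2]
  have hFK : Module.finrank F K = 2 := by
    have := Module.finrank_mul_finrank F K E
    rw [hcard, hKE] at this
    omega
  have hFL : Module.finrank F L = 2 := by
    have := Module.finrank_mul_finrank F L E
    rw [hcard, hLE] at this
    omega
  have hKσ : ∀ x : K, σ (x : E) = x := fun x =>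
    x.2 ⟨σ, Subgroup.mem_zpowers σ⟩
  have hLτ : ∀ x : L, τ (x : E) = x := fun x =>
    x.2 ⟨τ, Subgroup.mem_zpowers τ⟩
  obtain ⟨α, hα1, a, hα⟩ := quad_gen (F := F) (K := K) hFK
  obtain ⟨β, hβ1, b, hβ⟩ := quad_gen (F := F) (K := L) hFL
  refine tower_count (F := F) (K := K) (E := E) hFK hKE hα1 hα (β := (β : E)) (b := b) ?_ ?_
  · rintro ⟨y, hy⟩
    have h1 : σ (β : E) = β := by
      rw [← hy]; exact hKσ y
    obtain ⟨z, hz⟩ := hfix _ h1 (hLτ β)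
    exact hβ1 ⟨z, Subtype.ext hz⟩
  · exact congrArg Subtype.val hβ
end

section
/- Let p be a prime. For every cardinal number C there exists a field K of characteristic p such that dim_{𝔽_p}(K/℘(K)) = C, where ℘(x) = x^p - x. -/
/-- The subgroup ℘(K) = {x^p - x : x ∈ K} of (K, +) (as the additive subgroup it
generates; in characteristic p the Artin–Schreier map is additive, so this closure is
exactly the set of its values). -/
def asRange (p : ℕ) (K : Type*) [Field K] : AddSubgroup K :=
  AddSubgroup.closure (Set.range fun x : K => x ^ p - x)

/-- The `𝔽_p`-vector space structure on `K/℘(K)` for `K` of characteristic `p`. -/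
def asModule (p : ℕ) [NeZero p] (K : Type*) [Field K] [CharP K p] :
    Module (ZMod p) (K ⧸ asRange p K) :=
  QuotientAddGroup.zmodModule (fun x => by
    have h : (p : K) = 0 := CharP.cast_eq_zero K p
    simp only [nsmul_eq_mul, h, zero_mul]
    exact zero_mem _)

/-- A witness that there is a field `K` of characteristic `p` with
`dim_{𝔽_p}(K/℘(K)) = C`. -/
structure ASWitness (p : ℕ) [Fact p.Prime] (C : Cardinal) where
  K : Type
  [fieldK : Field K]
  [charK : CharP K p]
  rank_eq : letI := asModule p K; Module.rank (ZMod p) (K ⧸ asRange p K) = C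

open Polynomial IntermediateField

lemma fp_nat {L : Type*} [Field L] (p : ℕ) [Fact p.Prime] [CharP L p] {x : L} (h : x ^ p = x) :
    ∃ n : ℕ, x = n := by
  have := (Subfield.mem_bot_iff_pow_eq_self L p).2 h
  rw [← ZMod.fieldRange_castHom_eq_bot p] at this
  obtain ⟨z, rfl⟩ := this
  exact ⟨z.val, by simp⟩

lemma nat_fp {L : Type*} [Field L] (p : ℕ) [Fact p.Prime] [CharP L p] (n : ℕ) :
    (n : L) ^ p = n := by
  have := map_natCast (frobenius L p) n
  rwa [frobenius_def] at this

lemma as_key {F L : Type*} [Field F] [Field L] [Algebra F L] [IsGalois F L] (p : ℕ)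
    [Fact p.Prime] [CharP L p] (K : IntermediateField F L) {a b : L}
    (ha : a ^ p - a ∈ K) (hb : b ^ p - b ∈ K) (hba : b ∈ K ⊔ F⟮a⟯) :
    ∃ n : ℕ, b - n * a ∈ K := by
  have hK : ∀ x, (∀ σ ∈ K.fixingSubgroup, σ x = x) → x ∈ K := by
    intro x hx
    rw [← InfiniteGalois.fixedField_fixingSubgroup K]
    exact (mem_fixedField_iff _ _).2 hx
  have hchi : ∀ x, x ^ p - x ∈ K → ∀ σ ∈ K.fixingSubgroup, ∃ n : ℕ, σ x = x + n := by
    intro x hx σ hσ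
    have h1 := (mem_fixingSubgroup_iff K σ).1 hσ _ hx
    obtain ⟨n, hn⟩ := fp_nat p (x := σ x - x) (by
      rw [sub_pow_char]; simp only [map_sub, map_pow] at h1; linear_combination h1)
    exact ⟨n, by rw [← hn]; ring⟩
  have hfix : ∀ σ ∈ K.fixingSubgroup, σ a = a → σ b = b := by
    intro σ hσ h
    have : K ⊔ F⟮a⟯ ≤ fixedField (Subgroup.zpowers σ) := by
      refine sup_le ?_ ?_
      · rw [le_iff_le]; simpa using hσ
      · rw [adjoin_simple_le_iff, mem_fixedField_iff]
        intro f hf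
        have : Subgroup.zpowers σ ≤ MulAction.stabilizer Gal(L/F) a := by
          simpa using h
        exact this hf
    exact (mem_fixedField_iff _ _).1 (this hba) σ (Subgroup.mem_zpowers σ)
  by_cases hall : ∀ σ ∈ K.fixingSubgroup, σ a = a
  · exact ⟨0, by simpa using hK b fun σ hσ => hfix σ hσ (hall σ hσ)⟩
  push Not at hall
  obtain ⟨σ, hσ, hσa⟩ := hall
  obtain ⟨i, hi⟩ := hchi a ha σ hσ
  obtain ⟨j, hj⟩ := hchi b hb σ hσ
  have hi0 : (i : L) ≠ 0 := by rintro h; apply hσa; rw [hi, h, add_zero]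
  obtain ⟨m, hm⟩ := fp_nat p (x := (i : L)⁻¹) (by rw [inv_pow, nat_fp])
  have hmi : (m : L) * i = 1 := by rw [← hm]; exact inv_mul_cancel₀ hi0
  have hpow : ∀ k : ℕ, ∀ x : L, ∀ l : ℕ, σ x = x + l → (σ ^ k) x = x + k * l := by
    intro k x l h
    induction k with
    | zero => simp
    | succ k ih => rw [pow_succ, AlgEquiv.mul_apply, h, map_add, ih, map_natCast]; push_cast; ring
  refine ⟨j * m, hK _ fun τ hτ => ?_⟩
  obtain ⟨u, hu⟩ := hchi a ha τ hτ
  -- compare with the power of σ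
  set k := u * m with hk
  have h1 : ((σ ^ k)⁻¹ * τ) ∈ K.fixingSubgroup := mul_mem (inv_mem (pow_mem hσ k)) hτ
  have h2 : τ a = (σ ^ k) a := by
    rw [hu, hpow k a i hi, hk]; push_cast; linear_combination -(u : L) * hmi
  have h3 := hfix _ h1 (by
    rw [AlgEquiv.mul_apply, h2, ← AlgEquiv.mul_apply, inv_mul_cancel, AlgEquiv.one_apply])
  have h4 : τ b = (σ ^ k) b := by
    conv_rhs => rw [← h3]
    rw [← AlgEquiv.mul_apply, mul_inv_cancel_left]
  rw [map_sub, map_mul, map_natCast, h4, hpow k b j hj, hu, hk]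
  push_cast
  ring

lemma as_base (p : ℕ) [Fact p.Prime] (I : Type) (c : I →₀ ZMod p)
    (f : FractionRing (MvPolynomial I (ZMod p)))
    (h : f ^ p - f = algebraMap (MvPolynomial I (ZMod p)) _
      (Finsupp.linearCombination (ZMod p) MvPolynomial.X c)) : c = 0 := by
  have hp := (Fact.out : p.Prime)
  obtain ⟨g, rfl⟩ := IsIntegrallyClosed.algebraMap_eq_of_integral
    (R := MvPolynomial I (ZMod p)) (x := f) ⟨X ^ p - X - C (Finsupp.linearCombination (ZMod p) MvPolynomial.X c), by
      rw [sub_sub]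
      refine monic_X_pow_sub ((degree_X_add_C _).trans_lt ?_)
      exact_mod_cast hp.one_lt, by
      simp [← h]⟩
  rw [← map_pow, ← map_sub] at h
  replace h := IsFractionRing.injective _ _ h
  ext i
  by_contra hi
  rw [Finsupp.zero_apply] at hi
  classical
  have h2 := congrArg (MvPolynomial.aeval (R := ZMod p) (fun j => if j = i then (X : (ZMod p)[X]) else 0)) h
  rw [Finsupp.linearCombination_apply, Finsupp.sum, map_sum] at h2
  simp only [map_smul, MvPolynomial.aeval_X, smul_ite, smul_zero, Finset.sum_ite_eq', Finsupp.mem_support_iff] at h2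
  rw [if_pos hi, map_sub, map_pow] at h2
  generalize (MvPolynomial.aeval (R := ZMod p) (fun j => if j = i then (X : (ZMod p)[X]) else 0)) g = q at h2
  have hd := congrArg natDegree h2
  have hX : natDegree (c i • (X : (ZMod p)[X])) = 1 := by
    rw [smul_eq_C_mul]; exact natDegree_C_mul_X _ hi
  rw [hX] at hd
  have h1 : 1 < p := hp.one_lt
  rcases Nat.eq_zero_or_pos q.natDegree with h0 | h0
  · rw [natDegree_eq_zero] at h0
    obtain ⟨y, rfl⟩ := h0
    rw [← C_pow, ← C_sub, natDegree_C] at hd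
    omega
  · rw [natDegree_sub_eq_left_of_natDegree_lt, natDegree_pow] at hd
    · have := Nat.eq_one_of_mul_eq_one_right hd
      omega
    · rw [natDegree_pow]; nlinarith

lemma as_root {L : Type*} [Field L] [IsSepClosed L] (p : ℕ) [Fact p.Prime] [CharP L p] (a : L) :
    ∃ x : L, x ^ p - x = a := by
  have hp := (Fact.out : p.Prime)
  obtain ⟨x, hx⟩ := IsSepClosed.exists_root_C_mul_X_pow_add_C_mul_X_add_C (n := p) (1 : L) (-1) (-a)
    (by simp) hp.two_le (by simp)
  exact ⟨x, by linear_combination hx⟩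

lemma as_zorn {F L V : Type*} [Field F] [Field L] [Algebra F L] [IsGalois F L] [IsSepClosed L]
    (p : ℕ) [Fact p.Prime] [CharP L p] [AddCommGroup V] (T : V →+ F)
    (hT : ∀ c, ∀ f : F, f ^ p - f = T c → c = 0) :
    ∃ K : IntermediateField F L,
      (∀ c, ∀ f ∈ K, f ^ p - f = algebraMap F L (T c) → c = 0) ∧
      ∀ a ∈ K, ∃ c, ∃ f ∈ K, a = algebraMap F L (T c) + (f ^ p - f) := by
  obtain ⟨K, -, hK⟩ := zorn_le_nonempty₀
    {K : IntermediateField F L | ∀ c, ∀ f ∈ K, f ^ p - f = algebraMap F L (T c) → c = 0}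
    (by
      intro S hS hc y hy
      have : Nonempty S := ⟨⟨y, hy⟩⟩
      refine ⟨⨆ K : S, (K : IntermediateField F L), ?_, fun z hz => le_iSup (fun K : S => (K : IntermediateField F L)) ⟨z, hz⟩⟩
      intro c f hf h
      rw [← SetLike.mem_coe, coe_iSup_of_directed hc.directed, Set.mem_iUnion] at hf
      obtain ⟨K, hK⟩ := hf
      exact hS K.2 c f hK h) ⊥ (by
      intro c f hf h
      obtain ⟨g, rfl⟩ := mem_bot.1 hf
      rw [← map_pow, ← map_sub] at h
      exact hT c g ((algebraMap F L).injective h))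
  refine ⟨K, hK.1, ?_⟩
  by_contra! hcon
  obtain ⟨a, haK, ha⟩ := hcon
  obtain ⟨α, hα⟩ := as_root p a
  have hαK : α ∉ K := fun h => ha 0 α h (by simp [hα])
  refine hαK (hK.2 (y := K ⊔ F⟮α⟯) ?_ le_sup_left
    ((le_sup_right : F⟮α⟯ ≤ K ⊔ F⟮α⟯) (mem_adjoin_simple_self F α)))
  intro c b hb h
  obtain ⟨n, hn⟩ := as_key p K (a := α) (b := b) (hα ▸ haK) (h ▸ K.algebraMap_mem _) hb
  by_cases hn0 : (n : L) = 0
  · exact hK.1 c b (by simpa [hn0] using hn) h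
  exfalso
  obtain ⟨m, hm⟩ := fp_nat p (x := (n : L)⁻¹) (by rw [inv_pow, nat_fp])
  have hmi : (m : L) * n = 1 := by rw [← hm]; exact inv_mul_cancel₀ hn0
  refine ha (m • c) (-(m : L) * (b - n * α)) (mul_mem (neg_mem (_root_.natCast_mem K m)) hn) ?_
  have e1 : (-(m : L) * (b - n * α)) = α - m * b := by linear_combination α * hmi
  rw [e1, sub_pow_char, mul_pow, nat_fp]
  simp only [map_nsmul, nsmul_eq_mul, map_mul, map_natCast]
  linear_combination (m : L) * h - hα

lemma mem_asRange (p : ℕ) [Fact p.Prime] (K : Type*) [Field K] [CharP K p] (x : K) :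
    x ∈ asRange p K ↔ ∃ y : K, y ^ p - y = x := by
  constructor
  · intro h
    induction h using AddSubgroup.closure_induction with
    | mem x hx => exact hx
    | zero => exact ⟨0, by simp [(Fact.out : p.Prime).ne_zero]⟩
    | add x y _ _ hx hy =>
      obtain ⟨u, rfl⟩ := hx
      obtain ⟨v, rfl⟩ := hy
      exact ⟨u + v, by rw [add_pow_char]; ring⟩
    | neg x _ hx =>
      obtain ⟨u, rfl⟩ := hx
      have := sub_pow_char (0 : K) u (p := p)
      rw [zero_pow (Fact.out : p.Prime).ne_zero, zero_sub, zero_sub] at this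
      exact ⟨-u, by rw [this]; ring⟩
  · intro h
    exact AddSubgroup.subset_closure h

/-- for every prime p and every cardinal C there is a field K of
characteristic p with dim_{𝔽_p}(K/℘(K)) = C. -/
theorem stmt_15 (p : ℕ) [Fact p.Prime] (C : Cardinal) : Nonempty (ASWitness p C) := by
  let I : Type := C.out
  let F := FractionRing (MvPolynomial I (ZMod p))
  let L := SeparableClosure F
  have : CharP L p := charP_of_injective_algebraMap (algebraMap F L).injective p
  let T : (I →₀ ZMod p) →+ F :=
    (algebraMap (MvPolynomial I (ZMod p)) F).toAddMonoidHom.comp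
      (Finsupp.linearCombination (ZMod p) MvPolynomial.X).toAddMonoidHom
  obtain ⟨K, h1, h2⟩ := as_zorn (L := L) p T (fun c f h => as_base p I c f h)
  have : CharP K p := charP_of_injective_algebraMap (algebraMap F K).injective p
  refine ⟨⟨K, ?_⟩⟩
  letI := asModule p K
  let φ : (I →₀ ZMod p) →+ K ⧸ asRange p K :=
    (QuotientAddGroup.mk' (asRange p K)).comp ((algebraMap F K).toAddMonoidHom.comp T)
  have hφ : Function.Bijective φ := by
    constructor
    · rw [injective_iff_map_eq_zero]
      intro c hc
      have hc' : algebraMap F K (T c) ∈ asRange p K := (QuotientAddGroup.eq_zero_iff _).1 hc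
      obtain ⟨y, hy⟩ := (mem_asRange p K _).1 hc'
      exact h1 c y y.2 (congrArg (algebraMap K L) hy)
    · intro q
      obtain ⟨a, rfl⟩ := QuotientAddGroup.mk_surjective q
      obtain ⟨c, f, hf, h⟩ := h2 a a.2
      refine ⟨c, ?_⟩
      refine QuotientAddGroup.eq.2 ((mem_asRange p K _).2 ⟨⟨f, hf⟩, ?_⟩)
      apply Subtype.ext
      change f ^ p - f = -(algebraMap F L (T c)) + (a : L)
      rw [h]; ring
  have e := LinearEquiv.ofBijective (φ.toZModLinearMap p) hφ
  rw [← e.rank_eq, rank_finsupp_self]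
  simp [I]
end
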